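/- Let 1 ≤ m ≤ N−1 and assume t ≠ 0 and t^n ≠ 1 for 2 ≤ n ≤ N. Let τ := D(φ_{{N−m, N−m+1, …, N}}) ∈ P. If v lies in the span of {φ_E : #E = m}, satisfies D v = 0, and satisfies T_i v = −v for every i with N−m ≤ i ≤ N−1, then v is a scalar multiple of τ. Moreover, T_i τ = t τ for every i with 1 ≤ i ≤ N−m−2. -/

import Mathlib

open Finset

noncomputable def phi (K : Type*) [Field K] (E : Finset ℕ) : Finset ℕ →₀ K :=
  Finsupp.single E 1

noncomputable def Tgen {K : Type*} [Field K] (t : K) (i : ℕ) :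
    (Finset ℕ →₀ K) →ₗ[K] (Finset ℕ →₀ K) :=
  Finsupp.lift _ K _ fun E =>
    if i ∈ E then
      if i + 1 ∈ E then -(phi K E)
      else phi K (insert (i + 1) (E.erase i))
    else
      if i + 1 ∈ E then t • phi K (insert i (E.erase (i + 1))) + (t - 1) • phi K E
      else t • phi K E

def sgn (i : ℕ) (E : Finset ℕ) : ℕ := (E.filter (· < i)).card

noncomputable def Mop (K : Type*) [Field K] (N : ℕ) :
    (Finset ℕ →₀ K) →ₗ[K] (Finset ℕ →₀ K) :=
  Finsupp.lift _ K _ fun E =>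
    ∑ i ∈ (Finset.Icc 1 N) \ E, ((-1 : K) ^ sgn i E) • phi K (insert i E)

noncomputable def Dop {K : Type*} [Field K] (t : K) :
    (Finset ℕ →₀ K) →ₗ[K] (Finset ℕ →₀ K) :=
  Finsupp.lift _ K _ fun E =>
    ∑ i ∈ E, ((-1 : K) ^ sgn i E * t ^ (i - 1)) • phi K (E.erase i)

noncomputable def qint {K : Type*} [Field K] (t : K) (n : ℕ) : K :=
  ∑ i ∈ Finset.range n, t ^ i

noncomputable def kappa {K : Type*} [Field K] (t : K) (n : ℤ) : K :=
  if 0 < n then t ^ n.toNat / qint t n.toNat else -(1 / qint t (-n).toNat)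
section Coefficients

variable {K : Type*} [Field K]

theorem Tgen_phi (t : K) (i : ℕ) (E : Finset ℕ) :
    Tgen t i (phi K E) =
      if i ∈ E then
        if i + 1 ∈ E then -(phi K E)
        else phi K (insert (i + 1) (E.erase i))
      else
        if i + 1 ∈ E then t • phi K (insert i (E.erase (i + 1))) + (t - 1) • phi K E
        else t • phi K E := by
  rw [Tgen, Finsupp.lift_apply, phi, Finsupp.sum_single_index, one_smul]
  · rfl
  · rw [zero_smul]

theorem Dop_phi (t : K) (E : Finset ℕ) :
    Dop t (phi K E) = ∑ i ∈ E, ((-1 : K) ^ sgn i E * t ^ (i - 1)) • phi K (E.erase i) := by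
  simp [Dop, phi]

theorem finsupp_induction_phi {p : (Finset ℕ →₀ K) → Prop} (v : Finset ℕ →₀ K) (zero : p 0)
    (add : ∀ u w, p u → p w → p (u + w)) (smul_phi : ∀ F (a : K), p (a • phi K F)) : p v := by
  induction v using Finsupp.induction_linear with
  | zero => exact zero
  | add u w hu hw => exact add u w hu hw
  | single F a => simpa [phi] using smul_phi F a

theorem Tgen_apply_of_notMem_of_notMem (t : K) {i : ℕ} {E : Finset ℕ} (hi : i ∉ E)
    (hi' : i + 1 ∉ E) (v : Finset ℕ →₀ K) : Tgen t i v E = t * v E := by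
  induction v using finsupp_induction_phi with
  | zero => simp
  | add u w hu hw => simp [hu, hw, mul_add]
  | smul_phi F a =>
    have h₁ : ∀ G : Finset ℕ, insert i G ≠ E := by
      rintro G rfl; exact hi (mem_insert_self _ _)
    have h₂ : ∀ G : Finset ℕ, insert (i + 1) G ≠ E := by
      rintro G rfl; exact hi' (mem_insert_self _ _)
    rw [map_smul, Tgen_phi]
    by_cases hF : F = E
    · subst hF
      simp [hi, hi', phi, mul_comm]
    · split_ifs <;> simp [phi, hF, h₁, h₂]

theorem Tgen_apply_of_notMem_of_mem (t : K) {i : ℕ} {E : Finset ℕ} (hi : i ∉ E)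
    (hi' : i + 1 ∈ E) (v : Finset ℕ →₀ K) :
    Tgen t i v E = v (insert i (E.erase (i + 1))) + (t - 1) * v E := by
  induction v using finsupp_induction_phi with
  | zero => simp
  | add u w hu hw => simp only [map_add, Finsupp.add_apply, hu, hw]; ring
  | smul_phi F a =>
    have h₁ : ∀ G : Finset ℕ, insert i G ≠ E := by
      rintro G rfl; exact hi (mem_insert_self _ _)
    rw [map_smul, Tgen_phi]
    by_cases hF : F = E
    · subst hF
      simp [hi, hi', phi, h₁, (h₁ _).symm, mul_comm]
    · by_cases hG : F = insert i (E.erase (i + 1))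
      · have hE : insert (i + 1) (F.erase i) = E := by
          subst hG
          rw [erase_insert (by simp [hi]), insert_erase hi']
        have h₂ : i ∈ F := by simp [hG]
        have h₃ : i + 1 ∉ F := by simp [hG]
        simp [h₂, h₃, hE, phi, hF, ← hG]
      · have h₂ : i ∈ F → i + 1 ∉ F → insert (i + 1) (F.erase i) ≠ E := by
          rintro h h' rfl
          exact hG (by rw [erase_insert (by simp [h']), insert_erase h])
        split_ifs with h h' <;> simp_all [phi]

theorem apply_eq_zero_of_mem_span_phi {v : Finset ℕ →₀ K} {N m : ℕ}
    (hv : v ∈ Submodule.span K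
      {x : Finset ℕ →₀ K | ∃ E : Finset ℕ, E ⊆ Icc 1 N ∧ E.card = m ∧ x = phi K E})
    {E : Finset ℕ} (hE : E.card ≠ m) : v E = 0 := by
  induction hv using Submodule.span_induction with
  | mem x hx =>
    obtain ⟨F, -, hF, rfl⟩ := hx
    have : F ≠ E := by rintro rfl; exact hE hF
    simp [phi, this]
  | zero => simp
  | add u w _ _ hu hw => simp [hu, hw]
  | smul a u _ hu => simp [hu]

theorem apply_insert_erase_eq {t : K} {v : Finset ℕ →₀ K} {i : ℕ} (hv : Tgen t i v = -v)
    {E : Finset ℕ} (hi : i ∉ E) (hi' : i + 1 ∈ E) :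
    v (insert i (E.erase (i + 1))) = -t * v E := by
  have h := DFunLike.congr_fun hv E
  rw [Tgen_apply_of_notMem_of_mem t hi hi', Finsupp.neg_apply] at h
  linear_combination h

/-- A simultaneous `-1`-eigenvector of the `T_i`, `p ≤ i < q`, has no component on monomials
missing two of the variables indexed by `p, …, q`. -/
theorem apply_eq_zero_of_missing_two {t : K} (ht1 : t ≠ -1) {v : Finset ℕ →₀ K}
    {p q : ℕ} (hv : ∀ i, p ≤ i → i < q → Tgen t i v = -v) {a b : ℕ} (hpa : p ≤ a) (hab : a < b)
    (hbq : b ≤ q) {E : Finset ℕ} (ha : a ∉ E) (hb : b ∉ E) : v E = 0 := by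
  induction b, hab using Nat.le_induction generalizing E with
  | base =>
    have h := DFunLike.congr_fun (hv a hpa (by omega)) E
    rw [Tgen_apply_of_notMem_of_notMem t ha hb, Finsupp.neg_apply] at h
    have h' : (t + 1) * v E = 0 := by linear_combination h
    exact (mul_eq_zero.1 h').resolve_left fun h0 => ht1 (eq_neg_of_add_eq_zero_left h0)
  | succ b hab ih =>
    by_cases hbE : b ∈ E
    · have hF := ih (by omega) (E := insert (b + 1) (E.erase b))
        (by simp [ha]; omega) (by simp)
      have h := apply_insert_erase_eq (hv b (by omega) (by omega))
        (E := insert (b + 1) (E.erase b)) (by simp) (by simp)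
      rwa [erase_insert (by simp [hb]), insert_erase hbE, hF, mul_zero] at h
    · exact ih (by omega) ha hbE

theorem apply_erase_Icc_eq {t : K} {v : Finset ℕ →₀ K} {p q : ℕ}
    (hv : ∀ i, p ≤ i → i < q → Tgen t i v = -v) {j : ℕ} (hpj : p ≤ j) (hjq : j ≤ q) :
    v ((Icc p q).erase j) = (-t) ^ (j - p) * v ((Icc p q).erase p) := by
  induction j, hpj using Nat.le_induction with
  | base => simp
  | succ j hpj ih =>
    have h := apply_insert_erase_eq (hv j hpj (by omega)) (E := (Icc p q).erase j)
      (by simp) (by simp; omega)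
    have hE : insert j (((Icc p q).erase j).erase (j + 1)) = (Icc p q).erase (j + 1) := by
      ext x; simp only [mem_insert, mem_erase, mem_Icc]; omega
    rw [hE, ih (by omega)] at h
    rw [h, Nat.succ_sub hpj, pow_succ]
    ring

theorem sgn_Icc {p q j : ℕ} (hjq : j ≤ q) : sgn j (Icc p q) = j - p := by
  have : (Icc p q).filter (· < j) = Ico p j := by
    ext x; simp only [mem_filter, mem_Icc, mem_Ico]; omega
  rw [sgn, this, Nat.card_Ico]

theorem eq_sum_smul_phi_erase {v : Finset ℕ →₀ K} {B : Finset ℕ}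
    (hv : ∀ E, (∀ j ∈ B, E ≠ B.erase j) → v E = 0) :
    v = ∑ j ∈ B, v (B.erase j) • phi K (B.erase j) := by
  ext E
  rw [Finsupp.finsetSum_apply]
  by_cases h : ∃ j ∈ B, E = B.erase j
  · obtain ⟨j, hj, rfl⟩ := h
    rw [sum_eq_single_of_mem j hj fun k hk hkj => ?_]
    · simp [phi]
    · have : B.erase k ≠ B.erase j := fun h => hkj (erase_injOn B hk hj h)
      simp [phi, this]
  · push Not at h
    rw [hv E h, sum_eq_zero fun j hj => ?_]
    simp [phi, (h j hj).symm]

theorem exists_eq_erase_or_missing_two {B E : Finset ℕ} (h : E.card + 1 = B.card) :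
    (∃ j ∈ B, E = B.erase j) ∨ ∃ a ∈ B, ∃ b ∈ B, a < b ∧ a ∉ E ∧ b ∉ E := by
  by_cases hc : 1 < (B \ E).card
  · obtain ⟨a, ha, b, hb, hab⟩ := one_lt_card.1 hc
    rw [mem_sdiff] at ha hb
    rcases lt_or_gt_of_ne hab with hlt | hlt
    · exact .inr ⟨a, ha.1, b, hb.1, hlt, ha.2, hb.2⟩
    · exact .inr ⟨b, hb.1, a, ha.1, hlt, hb.2, ha.2⟩
  · have hle := le_card_sdiff E B
    obtain ⟨j, hj⟩ := card_eq_one.1 (show (B \ E).card = 1 by omega)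
    have hjB : j ∈ B := (mem_sdiff.1 (hj ▸ mem_singleton_self j)).1
    refine .inl ⟨j, hjB, (eq_of_subset_of_card_le ?_ ?_).symm⟩
    · rw [← sdiff_singleton_eq_erase, ← hj, sdiff_sdiff_right_self]
      exact inter_subset_right
    · rw [card_erase_of_mem hjB]; omega

end Coefficients

/-- Let `τ = D(φ_{{N−m,…,N}})`. Any `v` in the span of the fermionic monomials of
degree `m` (on variables indexed by `{1,…,N}`) with `D v = 0` and `T_i v = −v` for
`N−m ≤ i ≤ N−1` is a scalar multiple of `τ`; moreover `T_i τ = t·τ` for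
`1 ≤ i ≤ N−m−2`. -/
theorem type0_eigenvector_unique {K : Type*} [Field K] (t : K) (N m : ℕ)
    (hm1 : 1 ≤ m) (hmN : m ≤ N - 1) (ht0 : t ≠ 0)
    (htn : ∀ n : ℕ, 2 ≤ n → n ≤ N → t ^ n ≠ 1) :
    (∀ v : Finset ℕ →₀ K,
      v ∈ Submodule.span K
        {x : Finset ℕ →₀ K | ∃ E : Finset ℕ, E ⊆ Finset.Icc 1 N ∧ E.card = m ∧ x = phi K E} →
      Dop t v = 0 →
      (∀ i : ℕ, N - m ≤ i → i ≤ N - 1 → Tgen t i v = -v) →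
      ∃ c : K, v = c • Dop t (phi K (Finset.Icc (N - m) N))) ∧
    (∀ i : ℕ, 1 ≤ i → i ≤ N - m - 2 →
      Tgen t i (Dop t (phi K (Finset.Icc (N - m) N)))
        = t • Dop t (phi K (Finset.Icc (N - m) N))) := by
  obtain ⟨p, rfl⟩ : ∃ p, N = p + 1 + m := ⟨N - m - 1, by omega⟩
  have hp : p + 1 + m - m = p + 1 := by omega
  rw [hp, Dop_phi]
  refine ⟨fun v hspan _ hT => ?_, fun i _ hi => ?_⟩
  · have ht1 : t ≠ -1 := fun h => htn 2 le_rfl (by omega) (by simp [h])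
    have hv : ∀ i, p + 1 ≤ i → i < p + 1 + m → Tgen t i v = -v := fun i h h' =>
      hT i h (by omega)
    have hsum := eq_sum_smul_phi_erase (v := v) (B := Icc (p + 1) (p + 1 + m)) fun E hE => by
      by_cases hcard : E.card = m
      · rcases exists_eq_erase_or_missing_two (B := Icc (p + 1) (p + 1 + m)) (E := E)
            (by rw [Nat.card_Icc]; omega) with ⟨j, hj, h⟩ | ⟨a, ha, b, hb, hab, haE, hbE⟩
        · exact absurd h (hE j hj)
        · exact apply_eq_zero_of_missing_two ht1 hv (mem_Icc.1 ha).1 hab (mem_Icc.1 hb).2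
            haE hbE
      · exact apply_eq_zero_of_mem_span_phi hspan hcard
    refine ⟨v ((Icc (p + 1) (p + 1 + m)).erase (p + 1)) / t ^ p, ?_⟩
    rw [smul_sum]
    refine hsum.trans (sum_congr rfl fun j hj => ?_)
    obtain ⟨hpj, hjq⟩ := mem_Icc.1 hj
    rw [smul_smul, apply_erase_Icc_eq hv hpj hjq, sgn_Icc hjq]
    obtain ⟨k, rfl⟩ := Nat.exists_eq_add_of_le hpj
    have h₁ : p + 1 + k - (p + 1) = k := by omega
    have h₂ : p + 1 + k - 1 = p + k := by omega
    rw [h₁, h₂, neg_pow, pow_add]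
    congr 1
    field_simp
  · rw [map_sum, smul_sum]
    refine sum_congr rfl fun j _ => ?_
    have h₁ : i ∉ (Icc (p + 1) (p + 1 + m)).erase j := by
      simp only [mem_erase, mem_Icc]; omega
    have h₂ : i + 1 ∉ (Icc (p + 1) (p + 1 + m)).erase j := by
      simp only [mem_erase, mem_Icc]; omega
    rw [map_smul, Tgen_phi, if_neg h₁, if_neg h₂, smul_comm]
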